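/- (Joint continuity of the sandwiched Augustin auxiliary function.) Define E(s,P) := s·I^{(2),*}_{1/(1+s)}(P,W) for s ∈ (−1,1] with s ≠ 0, and E(0,P) := 0. Then the map (s,P) ↦ E(s,P) is jointly continuous on {s ∈ ℝ : −1 < s ≤ 1} × Δ_n, where Δ_n is the probability simplex of probability vectors on {1,…,n}. -/

import Mathlib

open Matrix
open scoped ComplexOrder

/-- Real power of a (hermitian) matrix via the continuous functional calculus. -/
noncomputable def mpow {ι : Type*} [Fintype ι] [DecidableEq ι]
    (A : Matrix ι ι ℂ) (r : ℝ) : Matrix ι ι ℂ :=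
  cfc (fun x : ℝ => x ^ r) A

/-- Logarithm of a (hermitian) matrix via the continuous functional calculus. -/
noncomputable def mlog {ι : Type*} [Fintype ι] [DecidableEq ι]
    (A : Matrix ι ι ℂ) : Matrix ι ι ℂ :=
  cfc Real.log A

/-- Real part of the trace. -/
noncomputable def trR {ι : Type*} [Fintype ι] (A : Matrix ι ι ℂ) : ℝ :=
  (Matrix.trace A).re

/-- Positive definite density matrices. -/
def Dens (d : ℕ) : Type :=
  {σ : Matrix (Fin d) (Fin d) ℂ // σ.PosDef ∧ σ.trace = 1}

/-- Sandwiched Rényi divergence of order `α ≠ 1`. -/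
noncomputable def Dsand {d : ℕ} (α : ℝ) (ρ σ : Matrix (Fin d) (Fin d) ℂ) : ℝ :=
  (1 / (α - 1)) * Real.log
    (trR (mpow (mpow σ ((1 - α) / (2 * α)) * ρ * mpow σ ((1 - α) / (2 * α))) α))

/-- Sandwiched Augustin information (order `α ≠ 1`). -/
noncomputable def sandwichedAugustinInfo {d n : ℕ} (α : ℝ)
    (W : Fin n → Matrix (Fin d) (Fin d) ℂ) (P : Fin n → ℝ) : ℝ :=
  ⨅ σ : Dens d, ∑ i, P i * Dsand α (W i) σ.1

/-- The sandwiched Augustin auxiliary function `E(s,P) := s·I^{(2),*}_{1/(1+s)}(P,W)`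
for `s ≠ 0`, with `E(0,P) := 0`. -/
noncomputable def Eaux {d n : ℕ} (W : Fin n → Matrix (Fin d) (Fin d) ℂ)
    (s : ℝ) (P : Fin n → ℝ) : ℝ :=
  if s = 0 then 0 else s * sandwichedAugustinInfo (1 / (1 + s)) W P

open scoped MatrixOrder Matrix.Norms.L2Operator

lemma trR_mono {ι : Type*} [Fintype ι] {A B : Matrix ι ι ℂ} (h : A ≤ B) : trR A ≤ trR B := by
  have := (Matrix.le_iff.1 h).trace_nonneg
  rw [Matrix.trace_sub, sub_nonneg] at this
  exact (Complex.le_def.1 this).1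

section MatrixPower

variable {ι : Type*} [Fintype ι] [DecidableEq ι] {A B : Matrix ι ι ℂ}

lemma mpow_eq_rpow (hA : A.PosDef) (r : ℝ) : mpow A r = A ^ r :=
  (CFC.rpow_eq_cfc_real hA.posSemidef.nonneg).symm

lemma mpow_posDef (hA : A.PosDef) (r : ℝ) : (mpow A r).PosDef := by
  rw [mpow_eq_rpow hA]
  exact (hA.isStrictlyPositive.rpow A r).posDef

lemma mpow_eq_exp_smul_mlog (hA : A.PosDef) (r : ℝ) :
    mpow A r = NormedSpace.exp (r • mlog A) := by
  have hpos : ∀ x ∈ spectrum ℝ A, 0 < x := fun x hx => hA.isStrictlyPositive.spectrum_pos hx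
  have hlog : ContinuousOn Real.log (spectrum ℝ A) := A.finite_real_spectrum.continuousOn _
  have hself : IsSelfAdjoint A := hA.isHermitian
  have hs : IsSelfAdjoint (r • mlog A) := (IsSelfAdjoint.all r).smul (cfc_predicate _ A)
  rw [← CFC.real_exp_eq_normedSpace_exp hs, mlog, ← cfc_smul r Real.log A hlog,
    ← cfc_comp' Real.exp _ A (by fun_prop), mpow]
  refine cfc_congr fun x hx => ?_
  simp only [Real.rpow_def_of_pos (hpos x hx), smul_eq_mul, mul_comm]

lemma mpow_smul (hA : A.PosDef) {c : ℝ} (hc : 0 < c) (r : ℝ) :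
    mpow (c • A) r = c ^ r • mpow A r := by
  have hpos : ∀ x ∈ spectrum ℝ A, 0 < x := fun x hx => hA.isStrictlyPositive.spectrum_pos hx
  have hself : IsSelfAdjoint A := hA.isHermitian
  rw [mpow, mpow, ← cfc_smul _ _ A (A.finite_real_spectrum.continuousOn _),
    ← cfc_comp_smul c _ A ((A.finite_real_spectrum.image _).continuousOn _)]
  refine cfc_congr fun x hx => ?_
  simp only [smul_eq_mul, Real.mul_rpow hc.le (hpos x hx).le]

lemma mpow_mul_mpow (hA : A.PosDef) (r t : ℝ) : mpow A r * mpow A t = mpow A (r + t) := by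
  simp only [mpow_eq_rpow hA, CFC.rpow_add hA.isUnit]

lemma mpow_one (hA : A.PosDef) : mpow A 1 = A := by
  rw [mpow_eq_rpow hA, CFC.rpow_one A hA.posSemidef.nonneg]

lemma mpow_le_mpow (hA : A.PosDef) (hB : B.PosDef) (hAB : A ≤ B) {r : ℝ} (hr : r ∈ Set.Icc (0 : ℝ) 1) :
    mpow A r ≤ mpow B r := by
  rw [mpow_eq_rpow hA, mpow_eq_rpow hB]
  exact CFC.rpow_le_rpow hr hAB

lemma mpow_neg_le_mpow_neg (hA : A.PosDef) (hB : B.PosDef) (hAB : A ≤ B) {r : ℝ}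
    (hr : r ∈ Set.Icc (0 : ℝ) 1) : mpow B (-r) ≤ mpow A (-r) := by
  have key : ∀ {C : Matrix ι ι ℂ}, C.PosDef → mpow C (-r) = Ring.inverse (C ^ r) := fun {C} hC => by
    have hC' : IsStrictlyPositive C := hC.isStrictlyPositive
    rcases eq_or_ne r 0 with rfl | hr0
    · simp [mpow_eq_rpow hC, CFC.rpow_zero C hC'.nonneg]
    · rw [CFC.inverse_eq_rpow_neg_one (hC'.rpow C r), mpow_eq_rpow hC,
        CFC.rpow_rpow C r (-1) hr0 hC', mul_neg_one]
  rw [key hA, key hB]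
  exact CStarAlgebra.ringInverse_le_ringInverse (CFC.rpow_le_rpow hr hAB)
    (hA.isStrictlyPositive.rpow A r)

lemma continuousOn_mlog : ContinuousOn mlog {A : Matrix ι ι ℂ | A.PosDef} :=
  (CFC.continuousOn_log (A := Matrix ι ι ℂ)).mono fun _ hA => ⟨hA.isHermitian, hA.isUnit⟩

lemma continuous_mpow {X : Type*} [TopologicalSpace X] {a : X → Matrix ι ι ℂ} {r : X → ℝ}
    (ha : Continuous a) (hr : Continuous r) (hpos : ∀ x, (a x).PosDef) :
    Continuous fun x => mpow (a x) (r x) := by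
  simp only [mpow_eq_exp_smul_mlog (hpos _)]
  let _ : NormedAlgebra ℚ (Matrix ι ι ℂ) := NormedAlgebra.restrictScalars ℚ ℝ _
  exact NormedSpace.exp_continuous.comp (hr.smul (continuousOn_mlog.comp_continuous ha hpos))

lemma trR_cfc (hA : A.IsHermitian) (f : ℝ → ℝ) :
    trR (cfc f A) = ∑ i, f (hA.eigenvalues i) := by
  rw [trR, hA.cfc_eq, Matrix.IsHermitian.cfc, Unitary.conjStarAlgAut_apply, Matrix.trace_mul_cycle]
  simp [Matrix.trace]

lemma trR_cfc_eq_of_charpoly_eq (hA : A.IsHermitian) (hB : B.IsHermitian)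
    (h : A.charpoly = B.charpoly) (f : ℝ → ℝ) : trR (cfc f A) = trR (cfc f B) := by
  have key : ∀ {C : Matrix ι ι ℂ}, C.IsHermitian →
      trR (cfc f C) = (C.charpoly.roots.map fun z => f z.re).sum := fun {C} hC => by
    rw [trR_cfc hC, hC.roots_charpoly_eq_eigenvalues]
    simp
  rw [key hA, key hB, h]

lemma sum_diag_le_trR_cfc (hB : B.PosSemidef) (V : Matrix.unitaryGroup ι ℂ) {f : ℝ → ℝ}
    (hf : ConvexOn ℝ (Set.Ici 0) f) :
    ∑ j, f ((star (V : Matrix ι ι ℂ) * B * V) j j).re ≤ trR (cfc f B) := by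
  set X : Matrix.unitaryGroup ι ℂ := star V * hB.isHermitian.eigenvectorUnitary with hX
  set b := hB.isHermitian.eigenvalues with hb
  have hrow : ∀ j, ∑ k, Complex.normSq ((X : Matrix ι ι ℂ) j k) = 1 := fun j => by
    have hX1 : (X : Matrix ι ι ℂ) * star (X : Matrix ι ι ℂ) = 1 :=
      Unitary.mul_star_self_of_mem X.2
    have h := congrFun₂ hX1 j j
    simp only [Matrix.mul_apply, Matrix.star_apply, Matrix.one_apply_eq, RCLike.star_def,
      Complex.mul_conj] at h
    exact_mod_cast h
  have hcol : ∀ k, ∑ j, Complex.normSq ((X : Matrix ι ι ℂ) j k) = 1 := fun k => by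
    have hX1 : star (X : Matrix ι ι ℂ) * (X : Matrix ι ι ℂ) = 1 :=
      Unitary.star_mul_self_of_mem X.2
    have h := congrFun₂ hX1 k k
    simp only [Matrix.mul_apply, Matrix.star_apply, Matrix.one_apply_eq, RCLike.star_def,
      ← Complex.normSq_eq_conj_mul_self] at h
    exact_mod_cast h
  have hentry : ∀ j, ((star (V : Matrix ι ι ℂ) * B * V) j j).re
      = ∑ k, Complex.normSq ((X : Matrix ι ι ℂ) j k) * b k := fun j => by
    have h : star (V : Matrix ι ι ℂ) * B * V
        = X * Matrix.diagonal (fun k => (b k : ℂ)) * star (X : Matrix ι ι ℂ) := by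
      conv_lhs => rw [hB.isHermitian.spectral_theorem, Unitary.conjStarAlgAut_apply]
      simp only [hX, Submonoid.coe_mul, Unitary.coe_star, star_mul, star_star, mul_assoc]
      rfl
    rw [h, Matrix.mul_apply]
    simp only [Matrix.mul_diagonal, Matrix.star_apply, Complex.re_sum]
    refine Finset.sum_congr rfl fun k _ => ?_
    rw [mul_right_comm, RCLike.star_def, Complex.mul_conj, ← Complex.ofReal_mul, Complex.ofReal_re]
  calc ∑ j, f ((star (V : Matrix ι ι ℂ) * B * V) j j).re
      ≤ ∑ j, ∑ k, Complex.normSq ((X : Matrix ι ι ℂ) j k) * f (b k) := by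
        refine Finset.sum_le_sum fun j _ => ?_
        rw [hentry]
        exact hf.map_sum_le (fun k _ => Complex.normSq_nonneg _) (hrow j)
          fun k _ => hB.eigenvalues_nonneg k
    _ = trR (cfc f B) := by
        rw [Finset.sum_comm, trR_cfc hB.isHermitian]
        simp only [← Finset.sum_mul, hcol, one_mul, hb]

lemma trR_mpow_mono (hA : A.PosDef) (hB : B.PosDef) (hAB : A ≤ B) {r : ℝ} (hr : 0 ≤ r) :
    trR (mpow A r) ≤ trR (mpow B r) := by
  rcases le_total r 1 with hr1 | hr1
  · exact trR_mono (mpow_le_mpow hA hB hAB ⟨hr, hr1⟩)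
  refine le_trans ?_ (sum_diag_le_trR_cfc hB.posSemidef hA.isHermitian.eigenvectorUnitary
    (convexOn_rpow hr1))
  rw [mpow, trR_cfc hA.isHermitian]
  refine Finset.sum_le_sum fun j _ => Real.rpow_le_rpow (hA.posSemidef.eigenvalues_nonneg j) ?_ hr
  set V := hA.isHermitian.eigenvectorUnitary with hV
  have h1 : hA.isHermitian.eigenvalues j = ((star (V : Matrix ι ι ℂ) * A * V) j j).re := by
    have h := hA.isHermitian.conjStarAlgAut_star_eigenvectorUnitary
    rw [Unitary.conjStarAlgAut_apply] at h
    simp only [Unitary.coe_star, star_star] at h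
    rw [hV, h]
    simp
  have h2 := (star_left_conjugate_le_conjugate hAB (V : Matrix ι ι ℂ))
  rw [h1]
  have h3 := (Matrix.le_iff.1 h2).diag_nonneg (i := j)
  rw [Matrix.sub_apply, sub_nonneg] at h3
  exact (Complex.le_def.1 h3).1

end MatrixPower

section SandwichedTrace

variable {ι : Type*} [Fintype ι] [DecidableEq ι] {ρ σ τ : Matrix ι ι ℂ}

/-- The trace functional `Tr[(σ^{s/2} ρ σ^{s/2})^{1/(1+s)}]`, which is the one inside the sandwiched
Rényi divergence of order `1/(1+s)`. -/
noncomputable def sandTrace (s : ℝ) (ρ σ : Matrix ι ι ℂ) : ℝ :=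
  trR (mpow (mpow σ (s / 2) * ρ * mpow σ (s / 2)) (1 / (1 + s)))

lemma sandwich_posDef (hρ : ρ.PosDef) (hσ : σ.PosDef) : (σ * ρ * σ).PosDef := by
  have h := (hσ.isUnit.posDef_star_left_conjugate_iff (x := ρ)).2 hρ
  rwa [Matrix.star_eq_conjTranspose, hσ.isHermitian.eq] at h

lemma sandTrace_pos [Nonempty ι] (s : ℝ) (hρ : ρ.PosDef) (hσ : σ.PosDef) :
    0 < sandTrace s ρ σ :=
  (Complex.lt_def.1 (mpow_posDef (sandwich_posDef hρ (mpow_posDef hσ _)) _).trace_pos).1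

lemma sandTrace_zero (hρ : ρ.PosDef) (hσ : σ.PosDef) : sandTrace 0 ρ σ = trR ρ := by
  have h : mpow σ 0 = 1 := by rw [mpow_eq_rpow hσ, CFC.rpow_zero σ hσ.posSemidef.nonneg]
  simp [sandTrace, h, mpow_one hρ]

lemma sandTrace_smul (hρ : ρ.PosDef) (hσ : σ.PosDef) {c : ℝ} (hc : 0 < c) (s : ℝ) :
    sandTrace s ρ (c • σ) = (c ^ s) ^ (1 / (1 + s)) * sandTrace s ρ σ := by
  have h : mpow (c • σ) (s / 2) * ρ * mpow (c • σ) (s / 2)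
      = c ^ s • (mpow σ (s / 2) * ρ * mpow σ (s / 2)) := by
    rw [mpow_smul hσ hc, smul_mul_assoc, smul_mul_assoc, mul_smul_comm, smul_smul,
      ← Real.rpow_add hc, add_halves]
  rw [sandTrace, h, mpow_smul (sandwich_posDef hρ (mpow_posDef hσ _)) (Real.rpow_pos_of_pos hc s),
    trR, Matrix.trace_smul, Complex.smul_re, smul_eq_mul, sandTrace, trR]

lemma sandTrace_eq (hρ : ρ.PosDef) (hσ : σ.PosDef) (s : ℝ) :
    sandTrace s ρ σ = trR (mpow (mpow ρ (1 / 2) * mpow σ s * mpow ρ (1 / 2)) (1 / (1 + s))) := by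
  refine trR_cfc_eq_of_charpoly_eq (sandwich_posDef hρ (mpow_posDef hσ _)).isHermitian
    (sandwich_posDef (mpow_posDef hσ _) (mpow_posDef hρ _)).isHermitian ?_ _
  have h1 : mpow σ (s / 2) * ρ * mpow σ (s / 2)
      = (mpow σ (s / 2) * mpow ρ (1 / 2)) * (mpow ρ (1 / 2) * mpow σ (s / 2)) := by
    have h : mpow ρ (1 / 2) * mpow ρ (1 / 2) = ρ := by
      rw [mpow_mul_mpow hρ, add_halves, mpow_one hρ]
    conv_lhs => rw [← h]
    simp only [mul_assoc]
  have h2 : mpow ρ (1 / 2) * mpow σ s * mpow ρ (1 / 2)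
      = (mpow ρ (1 / 2) * mpow σ (s / 2)) * (mpow σ (s / 2) * mpow ρ (1 / 2)) := by
    have h : mpow σ (s / 2) * mpow σ (s / 2) = mpow σ s := by
      rw [mpow_mul_mpow hσ, add_halves]
    rw [← h]
    simp only [mul_assoc]
  rw [h1, h2, Matrix.charpoly_mul_comm]

lemma sandTrace_le_of_mpow_le {s : ℝ} (hs : -1 < s) (hρ : ρ.PosDef) (hσ : σ.PosDef)
    (hτ : τ.PosDef) (h : mpow σ s ≤ mpow τ s) : sandTrace s ρ σ ≤ sandTrace s ρ τ := by
  rw [sandTrace_eq hρ hσ, sandTrace_eq hρ hτ]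
  have hR := mpow_posDef hρ (1 / 2)
  refine trR_mpow_mono (sandwich_posDef (mpow_posDef hσ _) hR)
    (sandwich_posDef (mpow_posDef hτ _) hR) ?_ (one_div_nonneg.2 (by linarith))
  have := star_left_conjugate_le_conjugate h (mpow ρ (1 / 2))
  rwa [Matrix.star_eq_conjTranspose, hR.isHermitian.eq] at this

lemma continuous_sandTrace {X : Type*} [TopologicalSpace X] {a : X → Matrix ι ι ℂ} {s : X → ℝ}
    (ha : Continuous a) (hs : Continuous s) (hs1 : ∀ x, -1 < s x) (hρ : ρ.PosDef)
    (hpos : ∀ x, (a x).PosDef) : Continuous fun x => sandTrace (s x) ρ (a x) := by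
  have h1 : Continuous fun x => mpow (a x) (s x / 2) := continuous_mpow ha (by fun_prop) hpos
  have h2 := continuous_mpow ((h1.mul continuous_const).mul h1 : Continuous fun x =>
    mpow (a x) (s x / 2) * ρ * mpow (a x) (s x / 2)) (r := fun x => 1 / (1 + s x))
    (continuous_const.div (by fun_prop) fun x => by linarith [hs1 x])
    fun x => sandwich_posDef hρ (mpow_posDef (hpos x) _)
  exact Complex.continuous_re.comp h2.matrix_trace

end SandwichedTrace

section WeightedDivergence

variable {d : ℕ} {ρ σ τ : Matrix (Fin d) (Fin d) ℂ}

lemma mul_Dsand {s : ℝ} (hs : -1 < s) (hs0 : s ≠ 0) :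
    s * Dsand (1 / (1 + s)) ρ σ = -(1 + s) * Real.log (sandTrace s ρ σ) := by
  have h1 : (1 + s) ≠ 0 := by linarith
  have h2 : (1 - 1 / (1 + s)) / (2 * (1 / (1 + s))) = s / 2 := by field_simp; ring
  have h3 : s * (1 / (1 / (1 + s) - 1)) = -(1 + s) := by
    have : 1 / (1 + s) - 1 = -s / (1 + s) := by field_simp; ring
    rw [this]
    field_simp
  rw [Dsand, h2, ← mul_assoc, h3, sandTrace]

lemma abs_mul_Dsand_of_nonneg {s : ℝ} (hs : 0 ≤ s) (hρ : ρ.PosDef) (hρ1 : ρ.trace = 1)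
    (hσ : σ.PosDef) :
    |s| * Dsand (1 / (1 + s)) ρ σ = -(1 + s) * Real.log (sandTrace s ρ σ) := by
  rcases hs.eq_or_lt with rfl | hs0
  · simp [sandTrace_zero hρ hσ, trR, hρ1]
  · rw [abs_of_pos hs0, mul_Dsand (by linarith) hs0.ne']

lemma abs_mul_Dsand_of_nonpos {s : ℝ} (hs1 : -1 < s) (hs : s ≤ 0) (hρ : ρ.PosDef)
    (hρ1 : ρ.trace = 1) (hσ : σ.PosDef) :
    |s| * Dsand (1 / (1 + s)) ρ σ = (1 + s) * Real.log (sandTrace s ρ σ) := by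
  rcases hs.eq_or_lt with rfl | hs0
  · simp [sandTrace_zero hρ hσ, trR, hρ1]
  · rw [abs_of_neg hs0, neg_mul, mul_Dsand hs1 hs0.ne, neg_mul, neg_neg]

lemma continuous_abs_mul_Dsand [NeZero d] {X : Type*} [TopologicalSpace X]
    {a : X → Matrix (Fin d) (Fin d) ℂ} {s : X → ℝ} (ha : Continuous a) (hs : Continuous s)
    (hs1 : ∀ x, -1 < s x) (hρ : ρ.PosDef) (hρ1 : ρ.trace = 1) (hpos : ∀ x, (a x).PosDef) :
    Continuous fun x => |s x| * Dsand (1 / (1 + s x)) ρ (a x) := by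
  have hlog : Continuous fun x => Real.log (sandTrace (s x) ρ (a x)) :=
    (continuous_sandTrace ha hs hs1 hρ hpos).log fun x => (sandTrace_pos _ hρ (hpos x)).ne'
  have hif : (fun x => |s x| * Dsand (1 / (1 + s x)) ρ (a x)) = fun x =>
      if 0 ≤ s x then -(1 + s x) * Real.log (sandTrace (s x) ρ (a x))
      else (1 + s x) * Real.log (sandTrace (s x) ρ (a x)) := by
    funext x
    split_ifs with h
    · exact abs_mul_Dsand_of_nonneg h hρ hρ1 (hpos x)
    · exact abs_mul_Dsand_of_nonpos (hs1 x) (not_le.1 h).le hρ hρ1 (hpos x)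
  rw [hif]
  refine Continuous.if_le (by fun_prop) (by fun_prop) continuous_const hs fun x hx => ?_
  simp [← hx, sandTrace_zero hρ (hpos x), trR, hρ1]

/-- The sandwiched Rényi divergence is antitone in its second argument. -/
lemma abs_mul_Dsand_antitone [NeZero d] {s : ℝ} (hs : s ∈ Set.Ioc (-1 : ℝ) 1) (hρ : ρ.PosDef)
    (hρ1 : ρ.trace = 1) (hσ : σ.PosDef) (hτ : τ.PosDef) (h : σ ≤ τ) :
    |s| * Dsand (1 / (1 + s)) ρ τ ≤ |s| * Dsand (1 / (1 + s)) ρ σ := by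
  have h1 : 0 < 1 + s := by linarith [hs.1]
  rcases le_total 0 s with hs0 | hs0
  · rw [abs_mul_Dsand_of_nonneg hs0 hρ hρ1 hσ, abs_mul_Dsand_of_nonneg hs0 hρ hρ1 hτ]
    have := Real.log_le_log (sandTrace_pos s hρ hσ)
      (sandTrace_le_of_mpow_le hs.1 hρ hσ hτ (mpow_le_mpow hσ hτ h ⟨hs0, hs.2⟩))
    nlinarith
  · rw [abs_mul_Dsand_of_nonpos hs.1 hs0 hρ hρ1 hσ, abs_mul_Dsand_of_nonpos hs.1 hs0 hρ hρ1 hτ]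
    have hpow := mpow_neg_le_mpow_neg hσ hτ h (r := -s) ⟨by linarith, by linarith [hs.1]⟩
    rw [neg_neg] at hpow
    exact mul_le_mul_of_nonneg_left (Real.log_le_log (sandTrace_pos s hρ hτ)
      (sandTrace_le_of_mpow_le hs.1 hρ hτ hσ hpow)) h1.le

lemma abs_mul_Dsand_smul [NeZero d] {s : ℝ} (hs : -1 < s) (hρ : ρ.PosDef)
    (hρ1 : ρ.trace = 1) (hσ : σ.PosDef) {c : ℝ} (hc : 0 < c) :
    |s| * Dsand (1 / (1 + s)) ρ (c • σ)
      = |s| * Dsand (1 / (1 + s)) ρ σ - |s| * Real.log c := by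
  have h1 : (1 + s) ≠ 0 := by linarith
  have hlog : Real.log (sandTrace s ρ (c • σ))
      = 1 / (1 + s) * (s * Real.log c) + Real.log (sandTrace s ρ σ) := by
    have hcs := Real.rpow_pos_of_pos hc s
    rw [sandTrace_smul hρ hσ hc, Real.log_mul (Real.rpow_pos_of_pos hcs _).ne'
      (sandTrace_pos s hρ hσ).ne', Real.log_rpow hcs, Real.log_rpow hc]
  rcases le_total 0 s with hs0 | hs0
  · rw [abs_mul_Dsand_of_nonneg hs0 hρ hρ1 hσ, abs_mul_Dsand_of_nonneg hs0 hρ hρ1 (hσ.smul hc),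
      hlog, abs_of_nonneg hs0]
    field_simp
    ring
  · rw [abs_mul_Dsand_of_nonpos hs hs0 hρ hρ1 hσ, abs_mul_Dsand_of_nonpos hs hs0 hρ hρ1 (hσ.smul hc),
      hlog, abs_of_nonpos hs0]
    field_simp
    ring

end WeightedDivergence

section Regularization

variable {d : ℕ}

lemma abs_iInf_sub_sInf_image_le {ι β : Type*} [Nonempty ι] {f : ι → ℝ} {g : β → ℝ} {K : Set β}
    {δ : ℝ} (hK : K.Nonempty) (hg : BddBelow (g '' K)) (h1 : ∀ b ∈ K, ∃ i, f i = g b)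
    (h2 : ∀ i, ∃ b ∈ K, g b ≤ f i + δ) (hδ : 0 ≤ δ) : |(⨅ i, f i) - sInf (g '' K)| ≤ δ := by
  have hlow : ∀ i, sInf (g '' K) - δ ≤ f i := fun i => by
    obtain ⟨b, hb, hbi⟩ := h2 i
    linarith [csInf_le hg (Set.mem_image_of_mem g hb)]
  have hle : ⨅ i, f i ≤ sInf (g '' K) := by
    refine le_csInf (hK.image g) ?_
    rintro _ ⟨b, hb, rfl⟩
    obtain ⟨i, hi⟩ := h1 b hb
    rw [← hi]
    exact ciInf_le ⟨_, Set.forall_mem_range.2 hlow⟩ i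
  rw [abs_le]
  constructor <;> linarith [le_ciInf hlow]

/-- The matrices `B` for which `Bᴴ * B` has unit trace: a compact parametrization of the density
matrices, the singular ones included. -/
def densitySphere (d : ℕ) : Set (Matrix (Fin d) (Fin d) ℂ) := {B | trR (Bᴴ * B) = 1}

/-- The mixture of the density matrix `Bᴴ * B` with the maximally mixed state. -/
noncomputable def mixDensity (ε : ℝ) (B : Matrix (Fin d) (Fin d) ℂ) : Matrix (Fin d) (Fin d) ℂ :=
  (1 - ε) • (Bᴴ * B) + (ε / d) • 1

lemma trace_conjTranspose_mul_self (B : Matrix (Fin d) (Fin d) ℂ) :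
    trR (Bᴴ * B) = ∑ j, ∑ i, ‖B i j‖ ^ 2 := by
  simp only [trR, Matrix.trace, Matrix.diag_apply, Matrix.mul_apply, Matrix.conjTranspose_apply,
    Complex.re_sum, RCLike.star_def, Complex.conj_mul']
  norm_cast

lemma isCompact_densitySphere (d : ℕ) : IsCompact (densitySphere d) := by
  have hK : IsCompact (Set.univ.pi fun _ : Fin d => Set.univ.pi fun _ : Fin d =>
      Metric.closedBall (0 : ℂ) 1) :=
    isCompact_univ_pi fun _ => isCompact_univ_pi fun _ => isCompact_closedBall 0 1
  refine hK.of_isClosed_subset (t := densitySphere d) ?_ fun B hB i _ j _ => ?_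
  · refine isClosed_eq (Complex.continuous_re.comp (Continuous.matrix_trace ?_)) continuous_const
    exact (continuous_id.matrix_conjTranspose).matrix_mul continuous_id
  · rw [densitySphere, Set.mem_ofPred_eq, trace_conjTranspose_mul_self] at hB
    have h1 : ‖B i j‖ ^ 2 ≤ ∑ i, ‖B i j‖ ^ 2 :=
      Finset.single_le_sum (f := fun i => ‖B i j‖ ^ 2) (fun _ _ => sq_nonneg _) (Finset.mem_univ i)
    have h2 : ∑ i, ‖B i j‖ ^ 2 ≤ ∑ j, ∑ i, ‖B i j‖ ^ 2 :=
      Finset.single_le_sum (f := fun j => ∑ i, ‖B i j‖ ^ 2)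
        (fun _ _ => Finset.sum_nonneg fun _ _ => sq_nonneg _) (Finset.mem_univ j)
    rw [mem_closedBall_zero_iff]
    exact (sq_le_one_iff₀ (norm_nonneg _)).1 (by linarith)

lemma exists_mem_densitySphere (σ : Dens d) : ∃ B ∈ densitySphere d, Bᴴ * B = σ.1 := by
  obtain ⟨B, hB⟩ := CStarAlgebra.nonneg_iff_eq_star_mul_self.1 σ.2.1.posSemidef.nonneg
  rw [Matrix.star_eq_conjTranspose] at hB
  refine ⟨B, ?_, hB.symm⟩
  rw [densitySphere, Set.mem_ofPred_eq, ← hB, trR, σ.2.2, Complex.one_re]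

lemma continuous_mixDensity (ε : ℝ) :
    Continuous (mixDensity ε : Matrix (Fin d) (Fin d) ℂ → Matrix (Fin d) (Fin d) ℂ) := by
  have h : Continuous fun B : Matrix (Fin d) (Fin d) ℂ => Bᴴ * B :=
    (continuous_id.matrix_conjTranspose).matrix_mul continuous_id
  exact (h.const_smul (1 - ε)).add continuous_const

variable [NeZero d] {ε : ℝ}

lemma div_dim_pos (hε : 0 < ε) : 0 < ε / d :=
  div_pos hε (Nat.cast_pos.2 (NeZero.pos d))

lemma mixDensity_posDef (hε : ε ∈ Set.Ioo (0 : ℝ) 1) (B : Matrix (Fin d) (Fin d) ℂ) :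
    (mixDensity ε B).PosDef :=
  Matrix.PosDef.posSemidef_add
    ((Matrix.posSemidef_conjTranspose_mul_self B).smul (sub_nonneg.2 hε.2.le))
    (Matrix.PosDef.one.smul (div_dim_pos hε.1))

lemma le_mixDensity (hε : 0 < ε) (B : Matrix (Fin d) (Fin d) ℂ) :
    (1 - ε) • (Bᴴ * B) ≤ mixDensity ε B :=
  le_add_of_nonneg_right (Matrix.PosDef.one.smul (div_dim_pos hε)).posSemidef.nonneg

lemma mixDensity_trace {B : Matrix (Fin d) (Fin d) ℂ} (hB : B ∈ densitySphere d) :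
    (mixDensity ε B).trace = 1 := by
  have hd : (d : ℂ) ≠ 0 := NeZero.ne _
  have h1 : (Bᴴ * B).trace = 1 := by
    refine Complex.ext hB ?_
    exact (Complex.le_def.1 (Matrix.posSemidef_conjTranspose_mul_self B).trace_nonneg).2.symm
  rw [mixDensity, Matrix.trace_add, Matrix.trace_smul, Matrix.trace_smul, h1, Matrix.trace_one,
    Fintype.card_fin, Complex.real_smul, Complex.real_smul]
  push_cast
  field_simp
  ring

instance : Nonempty (Dens d) :=
  ⟨⟨((d : ℝ)⁻¹) • 1, Matrix.PosDef.one.smul (inv_pos.2 (Nat.cast_pos.2 (NeZero.pos d))), by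
    simp [Matrix.trace_smul]⟩⟩

lemma densitySphere_nonempty : (densitySphere d).Nonempty :=
  let ⟨B, hB, _⟩ := exists_mem_densitySphere (Classical.arbitrary (Dens d))
  ⟨B, hB⟩

end Regularization

section Augustin

variable {d n : ℕ} {W : Fin n → Matrix (Fin d) (Fin d) ℂ}

/-- The objective `|s| ∑ i, P i * D_{1/(1+s)}(W i ‖ σ)` of the Augustin minimization. -/
noncomputable def augustinObjective (W : Fin n → Matrix (Fin d) (Fin d) ℂ) (s : ℝ)
    (P : Fin n → ℝ) (σ : Matrix (Fin d) (Fin d) ℂ) : ℝ :=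
  ∑ i, P i * (|s| * Dsand (1 / (1 + s)) (W i) σ)

lemma abs_mul_sandwichedAugustinInfo (s : ℝ) (P : Fin n → ℝ) :
    |s| * sandwichedAugustinInfo (1 / (1 + s)) W P = ⨅ σ : Dens d, augustinObjective W s P σ.1 := by
  rw [sandwichedAugustinInfo, Real.mul_iInf_of_nonneg (abs_nonneg s)]
  simp only [augustinObjective, Finset.mul_sum, mul_left_comm]

lemma Eaux_eq (s : ℝ) (P : Fin n → ℝ) :
    Eaux W s P = if 0 ≤ s then ⨅ σ : Dens d, augustinObjective W s P σ.1
      else -⨅ σ : Dens d, augustinObjective W s P σ.1 := by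
  rw [← abs_mul_sandwichedAugustinInfo, Eaux]
  split_ifs with h0 h1 h1
  · simp [h0]
  · simp [h0]
  · rw [abs_of_nonneg h1]
  · rw [abs_of_neg (not_le.1 h1), neg_mul, neg_neg]

variable [NeZero d] {ε : ℝ}

lemma continuous_augustinObjective (hW : ∀ i, (W i).PosDef ∧ (W i).trace = 1) {X : Type*}
    [TopologicalSpace X] {a : X → Matrix (Fin d) (Fin d) ℂ} {s : X → ℝ} {P : X → Fin n → ℝ}
    (ha : Continuous a) (hs : Continuous s) (hP : Continuous P) (hs1 : ∀ x, -1 < s x)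
    (hpos : ∀ x, (a x).PosDef) : Continuous fun x => augustinObjective W (s x) (P x) (a x) :=
  continuous_finsetSum _ fun i _ => ((continuous_apply i).comp hP).mul
    (continuous_abs_mul_Dsand ha hs hs1 (hW i).1 (hW i).2 hpos)

lemma augustinObjective_mixDensity_le (hW : ∀ i, (W i).PosDef ∧ (W i).trace = 1)
    (hε : ε ∈ Set.Ioo (0 : ℝ) 1) {s : ℝ} (hs : s ∈ Set.Ioc (-1 : ℝ) 1) {P : Fin n → ℝ}
    (hP0 : ∀ i, 0 ≤ P i) (hP1 : ∑ i, P i = 1) {B : Matrix (Fin d) (Fin d) ℂ}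
    (hB : (Bᴴ * B).PosDef) :
    augustinObjective W s P (mixDensity ε B)
      ≤ augustinObjective W s P (Bᴴ * B) + -Real.log (1 - ε) := by
  have hc : 0 < 1 - ε := sub_pos.2 hε.2
  have hlog : Real.log (1 - ε) ≤ 0 := Real.log_nonpos hc.le (by linarith [hε.1])
  have hsabs : |s| ≤ 1 := abs_le.2 ⟨hs.1.le, hs.2⟩
  have hterm : ∀ i, |s| * Dsand (1 / (1 + s)) (W i) (mixDensity ε B)
      ≤ |s| * Dsand (1 / (1 + s)) (W i) (Bᴴ * B) + -Real.log (1 - ε) := fun i => by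
    have h1 := abs_mul_Dsand_antitone hs (hW i).1 (hW i).2 (hB.smul hc) (mixDensity_posDef hε B)
      (le_mixDensity hε.1 B)
    rw [abs_mul_Dsand_smul hs.1 (hW i).1 (hW i).2 hB hc] at h1
    nlinarith
  calc augustinObjective W s P (mixDensity ε B)
      ≤ ∑ i, P i * (|s| * Dsand (1 / (1 + s)) (W i) (Bᴴ * B) + -Real.log (1 - ε)) :=
        Finset.sum_le_sum fun i _ => mul_le_mul_of_nonneg_left (hterm i) (hP0 i)
    _ = augustinObjective W s P (Bᴴ * B) + -Real.log (1 - ε) := by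
        simp only [mul_add, Finset.sum_add_distrib, ← Finset.sum_mul, hP1, one_mul,
          augustinObjective]

lemma exists_continuous_approx_Eaux (hW : ∀ i, (W i).PosDef ∧ (W i).trace = 1)
    (hε : ε ∈ Set.Ioo (0 : ℝ) 1) :
    ∃ F : (Set.Ioc (-1 : ℝ) 1 ×ˢ {P : Fin n → ℝ | (∀ i, 0 ≤ P i) ∧ ∑ i, P i = 1} :
        Set (ℝ × (Fin n → ℝ))) → ℝ,
      Continuous F ∧ ∀ q, |Eaux W q.1.1 q.1.2 - F q| ≤ -Real.log (1 - ε) := by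
  set D : Set (ℝ × (Fin n → ℝ)) :=
    Set.Ioc (-1 : ℝ) 1 ×ˢ {P : Fin n → ℝ | (∀ i, 0 ≤ P i) ∧ ∑ i, P i = 1}
  set g : D → Matrix (Fin d) (Fin d) ℂ → ℝ :=
    fun q B => augustinObjective W q.1.1 q.1.2 (mixDensity ε B)
  have hg : Continuous (Function.uncurry g) := by
    refine continuous_augustinObjective (X := D × Matrix (Fin d) (Fin d) ℂ) hW
      ((continuous_mixDensity ε).comp continuous_snd) (by fun_prop) (by fun_prop)
      (fun x => x.1.2.1.1) fun x => mixDensity_posDef hε x.2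
  have hinf : Continuous fun q => sInf (g q '' densitySphere d) :=
    (isCompact_densitySphere d).continuous_sInf hg
  have hδ : 0 ≤ -Real.log (1 - ε) :=
    neg_nonneg.2 (Real.log_nonpos (sub_nonneg.2 hε.2.le) (by linarith [hε.1]))
  refine ⟨fun q => if 0 ≤ q.1.1 then sInf (g q '' densitySphere d)
    else -sInf (g q '' densitySphere d), ?_, fun q => ?_⟩
  · refine Continuous.if_le hinf hinf.neg continuous_const (by fun_prop) fun q hq => ?_
    have h0 : g q = fun _ => 0 := by
      funext B
      simp [g, augustinObjective, ← hq]
    simp [h0, densitySphere_nonempty.image_const]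
  · have key : |(⨅ σ : Dens d, augustinObjective W q.1.1 q.1.2 σ.1)
        - sInf (g q '' densitySphere d)| ≤ -Real.log (1 - ε) := by
      refine abs_iInf_sub_sInf_image_le densitySphere_nonempty
        ((isCompact_densitySphere d).bddBelow_image
          (hg.comp (Continuous.prodMk_right q)).continuousOn) (fun B hB => ?_) (fun σ => ?_) hδ
      · exact ⟨⟨mixDensity ε B, mixDensity_posDef hε B, mixDensity_trace hB⟩, rfl⟩
      · obtain ⟨B, hB, hBσ⟩ := exists_mem_densitySphere σ
        refine ⟨B, hB, ?_⟩
        rw [← hBσ]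
        exact augustinObjective_mixDensity_le hW hε q.2.1 q.2.2.1 q.2.2.2 (hBσ ▸ σ.2.1)
    beta_reduce
    rw [Eaux_eq]
    split_ifs
    · exact key
    · rwa [neg_sub_neg, abs_sub_comm]

end Augustin

/-- joint continuity of the sandwiched Augustin auxiliary function
on `(-1,1] × Δ_n`. -/
theorem sandwiched_augustin_auxiliary_joint_continuity {d n : ℕ} (hd : 0 < d) (hn : 0 < n)
    (W : Fin n → Matrix (Fin d) (Fin d) ℂ)
    (hW : ∀ i, (W i).PosDef ∧ (W i).trace = 1) :
    ContinuousOn (fun q : ℝ × (Fin n → ℝ) => Eaux W q.1 q.2)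
      (Set.Ioc (-1 : ℝ) 1 ×ˢ {P : Fin n → ℝ | (∀ i, 0 ≤ P i) ∧ ∑ i, P i = 1}) := by
  have : NeZero d := ⟨hd.ne'⟩
  rw [continuousOn_iff_continuous_domRestrict]
  refine continuous_of_uniform_approx_of_continuous fun u hu => ?_
  obtain ⟨δ, hδ, hu⟩ := Metric.mem_uniformity_dist.1 hu
  have hε : 1 - Real.exp (-(δ / 2)) ∈ Set.Ioo (0 : ℝ) 1 :=
    ⟨sub_pos.2 (Real.exp_lt_one_iff.2 (by linarith)), sub_lt_self _ (Real.exp_pos _)⟩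
  obtain ⟨F, hF, hEF⟩ := exists_continuous_approx_Eaux hW hε
  refine ⟨F, hF, fun q => hu ?_⟩
  have h := hEF q
  rw [sub_sub_cancel, Real.log_exp, neg_neg] at h
  exact (Real.dist_eq _ _).trans_lt (h.trans_lt (half_lt_self hδ))
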